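/- arXiv:1702.08028 — 5 statements merged into one kernel-verified Lean document; each statement's English description precedes it below -/
import Mathlib

section
/- Let a < b be real numbers, α > 0, β ∈ ℝ, and let u, f : [a,b] → ℝ be continuous functions such that u(t) ≤ f(t) + α ∫ₐᵗ exp(−β(t−τ)) u(τ) dτ for all t ∈ [a,b]. Then u(t) ≤ f(t) + α ∫ₐᵗ exp((α−β)(t−τ)) f(τ) dτ for all t ∈ [a,b]. -/
open Set MeasureTheory in
/-- Gronwall's inequality in integral form: if `v ≤ g + α ∫ v`, then the primitive of `v` is
bounded by the solution of the corresponding linear equation. -/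
theorem integral_le_of_le_add_mul_integral {a t α : ℝ} (hat : a ≤ t) {v g : ℝ → ℝ}
    (hv : ContinuousOn v (Icc a t)) (hg : ContinuousOn g (Icc a t))
    (h : ∀ x ∈ Ioo a t, v x ≤ g x + α * ∫ τ in a..x, v τ) :
    ∫ τ in a..t, v τ ≤ Real.exp (α * t) * ∫ τ in a..t, Real.exp (-α * τ) * g τ := by
  have hexp (c x : ℝ) : HasDerivAt (fun x => Real.exp (c * x)) (Real.exp (c * x) * c) x := by
    simpa using ((hasDerivAt_id x).const_mul c).exp
  have hderiv : ∀ x ∈ Ioo a t, HasDerivWithinAt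
      (fun x => Real.exp (-α * x) * ∫ τ in a..x, v τ)
      (Real.exp (-α * x) * -α * (∫ τ in a..x, v τ) + Real.exp (-α * x) * v x) (Ioi x) x := by
    intro x hx
    have hV : HasDerivAt (fun x => ∫ τ in a..x, v τ) (v x) x := by
      refine intervalIntegral.integral_hasDerivAt_right ?_ ?_ ?_
      · refine (hv.mono ?_).intervalIntegrable
        rw [uIcc_of_le hx.1.le]
        exact Icc_subset_Icc_right hx.2.le
      · exact (hv.mono Ioo_subset_Icc_self).stronglyMeasurableAtFilter isOpen_Ioo x hx
      · exact hv.continuousAt (Icc_mem_nhds hx.1 hx.2)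
    exact ((hexp (-α) x).mul hV).hasDerivWithinAt
  have hcont : ContinuousOn (fun x => Real.exp (-α * x) * ∫ τ in a..x, v τ) (Icc a t) := by
    refine ContinuousOn.mul (by fun_prop) ?_
    have := intervalIntegral.continuousOn_primitive_interval (μ := volume) (a := a) (b := t)
      (f := v) (by rw [uIcc_of_le hat]; exact hv.integrableOn_Icc)
    rwa [uIcc_of_le hat] at this
  have key := intervalIntegral.sub_le_integral_of_hasDeriv_right_of_le hat hcont hderiv
    (φ := fun τ => Real.exp (-α * τ) * g τ)
    (ContinuousOn.integrableOn_Icc (ContinuousOn.mul (by fun_prop) hg))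
    (fun x hx => by nlinarith [mul_le_mul_of_nonneg_left (h x hx) (Real.exp_pos (-α * x)).le])
  simp only [intervalIntegral.integral_same, mul_zero, sub_zero] at key
  have := mul_le_mul_of_nonneg_left key (Real.exp_pos (α * t)).le
  rwa [← mul_assoc, ← Real.exp_add, neg_mul, add_neg_cancel, Real.exp_zero, one_mul] at this

/-- Gronwall-type integral inequality with exponential kernel. -/
theorem gronwall_exponential_kernel (a b α β : ℝ) (hab : a < b) (hα : 0 < α)
    (u f : ℝ → ℝ)
    (hu : ContinuousOn u (Set.Icc a b)) (hf : ContinuousOn f (Set.Icc a b))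
    (h : ∀ t ∈ Set.Icc a b,
      u t ≤ f t + α * ∫ τ in a..t, Real.exp (-β * (t - τ)) * u τ) :
    ∀ t ∈ Set.Icc a b,
      u t ≤ f t + α * ∫ τ in a..t, Real.exp ((α - β) * (t - τ)) * f τ := by
  have hker (x : ℝ) : ∫ τ in a..x, Real.exp (-β * (x - τ)) * u τ =
      Real.exp (-β * x) * ∫ τ in a..x, Real.exp (β * τ) * u τ := by
    rw [← intervalIntegral.integral_const_mul]
    congr 1 with τ
    rw [← mul_assoc, ← Real.exp_add]
    ring_nf
  intro t ht
  have hsub : Set.Icc a t ⊆ Set.Icc a b := Set.Icc_subset_Icc_right ht.2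
  have key := integral_le_of_le_add_mul_integral (α := α) ht.1
    (v := fun τ => Real.exp (β * τ) * u τ) (g := fun τ => Real.exp (β * τ) * f τ)
    (ContinuousOn.mul (by fun_prop) (hu.mono hsub))
    (ContinuousOn.mul (by fun_prop) (hf.mono hsub))
    (fun x hx => by
      have hx' := h x (hsub (Set.Ioo_subset_Icc_self hx))
      rw [hker] at hx'
      have hmul := mul_le_mul_of_nonneg_left hx' (Real.exp_pos (β * x)).le
      have hone : Real.exp (β * x) * Real.exp (-β * x) = 1 := by
        rw [← Real.exp_add]; simp
      refine hmul.trans_eq ?_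
      linear_combination (α * ∫ τ in a..x, Real.exp (β * τ) * u τ) * hone)
  have hres : Real.exp (-β * t) * (Real.exp (α * t) *
      ∫ τ in a..t, Real.exp (-α * τ) * (Real.exp (β * τ) * f τ)) =
      ∫ τ in a..t, Real.exp ((α - β) * (t - τ)) * f τ := by
    rw [← intervalIntegral.integral_const_mul, ← intervalIntegral.integral_const_mul]
    congr 1 with τ
    simp only [← mul_assoc, ← Real.exp_add]
    ring_nf
  refine (h t ht).trans ?_
  rw [hker, ← hres]
  gcongr
end

section
/- Let X be a real Banach space, a < b, and let f : (a,b) → X be Lipschitz. Then limsup_{s → 0⁺} sup_{α : α, α−s ∈ (a,b)} (1/s) ‖f(α−s) − f(α)‖ ≤ sup_{α ∈ (a,b)} limsup_{s → 0⁺} (1/s) ‖f(α−s) − f(α)‖. -/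
open Filter Set Topology in
/-- Near `0`, restricting to steps that keep `α - s` inside `(a, b)` is no restriction. -/
theorem nhdsWithin_backward_steps {a b α : ℝ} (hα : α ∈ Ioo a b) :
    𝓝[{s : ℝ | 0 < s ∧ α - s ∈ Ioo a b}] (0 : ℝ) = 𝓝[>] 0 := by
  have h : {s : ℝ | α - s ∈ Ioo a b} ∈ 𝓝 (0 : ℝ) := by
    have hc : ContinuousAt (fun s : ℝ => α - s) 0 := by fun_prop
    exact hc (by simpa using Ioo_mem_nhds hα.1 hα.2)
  exact nhdsWithin_inter_of_mem' (mem_nhdsWithin_of_mem_nhds h)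

open Filter Set Topology in
/-- A continuous curve whose upper right speed is at most `M` moves by at most `M * s`
in time `s`. -/
theorem norm_sub_le_of_frequently_right_quotient_lt {X : Type*} [NormedAddCommGroup X]
    {g : ℝ → X} {M s : ℝ} (hs : 0 ≤ s) (hg : ContinuousOn g (Icc 0 s))
    (h : ∀ t ∈ Ico 0 s, ∀ r, M < r → ∃ᶠ u in 𝓝[>] (0 : ℝ), ‖g (t + u) - g t‖ / u < r) :
    ‖g s - g 0‖ ≤ M * s := by
  refine image_le_of_liminf_slope_right_le_deriv_boundary (f := fun t => ‖g t - g 0‖)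
    (B := fun t => M * t) (B' := fun _ => M) (a := 0) (b := s)
    (hg.sub continuousOn_const).norm (by simp) (by fun_prop)
    (fun x _ => by simpa using ((hasDerivAt_id x).const_mul M).hasDerivWithinAt)
    (fun t ht r hr => ?_) (right_mem_Icc.2 hs)
  have hmap : Tendsto (fun u : ℝ => t + u) (𝓝[>] 0) (𝓝[>] t) := by
    refine tendsto_nhdsWithin_iff.2 ⟨?_, ?_⟩
    · have hc : ContinuousAt (fun u : ℝ => t + u) 0 := by fun_prop
      simpa [ContinuousAt] using hc.tendsto.mono_left nhdsWithin_le_nhds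
    · filter_upwards [self_mem_nhdsWithin] with u hu
      simpa using hu
  refine hmap.frequently (((h t ht r hr).and_eventually self_mem_nhdsWithin).mono ?_)
  rintro u ⟨hu, hu0⟩
  have hu0 : 0 < u := hu0
  refine lt_of_le_of_lt ?_ hu
  rw [slope_def_field, add_sub_cancel_left]
  gcongr
  simpa using norm_sub_norm_le (g (t + u) - g 0) (g t - g 0)

open Filter Set Topology in
/-- For a Lipschitz `f : (a,b) → X`, the limsup (as `s → 0⁺`) of the
supremum over admissible `α` of the backward difference quotients is at most the
supremum over `α ∈ (a,b)` of the pointwise limsups. -/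
theorem limsup_sup_le_sup_limsup {X : Type*} [NormedAddCommGroup X]
    [NormedSpace ℝ X] (a b : ℝ) (hab : a < b) (f : ℝ → X) (K : NNReal)
    (hf : LipschitzOnWith K f (Set.Ioo a b)) :
    Filter.limsup (fun s : ℝ =>
        ⨆ α ∈ {α : ℝ | α ∈ Set.Ioo a b ∧ α - s ∈ Set.Ioo a b},
          ‖f (α - s) - f α‖ / s)
      (nhdsWithin 0 (Set.Ioi 0))
      ≤ ⨆ α ∈ Set.Ioo a b,
          Filter.limsup (fun s : ℝ => ‖f (α - s) - f α‖ / s)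
            (nhdsWithin 0 {s : ℝ | 0 < s ∧ α - s ∈ Set.Ioo a b}) := by
  have hq : ∀ α ∈ Ioo a b, ∀ᶠ s in 𝓝[>] (0 : ℝ), ‖f (α - s) - f α‖ / s ≤ K := by
    intro α hα
    rw [← nhdsWithin_backward_steps hα]
    filter_upwards [self_mem_nhdsWithin] with s hs
    rw [div_le_iff₀ hs.1]
    simpa [abs_of_pos hs.1] using hf.norm_sub_le hs.2 hα
  have hq0 : ∀ α, ∀ᶠ s in 𝓝[>] (0 : ℝ), 0 ≤ ‖f (α - s) - f α‖ / s := by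
    intro α
    filter_upwards [self_mem_nhdsWithin] with s hs
    have hs : 0 < s := hs
    positivity
  set L : ℝ → ℝ := fun α => limsup (fun s : ℝ => ‖f (α - s) - f α‖ / s)
    (𝓝[{s : ℝ | 0 < s ∧ α - s ∈ Ioo a b}] 0) with hL
  have hLeq : ∀ α ∈ Ioo a b, L α = limsup (fun s : ℝ => ‖f (α - s) - f α‖ / s) (𝓝[>] 0) :=
    fun α hα => by simp only [hL, nhdsWithin_backward_steps hα]
  have hLK : ∀ α ∈ Ioo a b, L α ≤ K := fun α hα => by
    rw [hLeq α hα]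
    exact limsup_le_of_le (isBoundedUnder_of_eventually_ge (hq0 α)).isCoboundedUnder_le (hq α hα)
  have hL0 : ∀ α ∈ Ioo a b, 0 ≤ L α := fun α hα => by
    rw [hLeq α hα]
    exact le_limsup_of_frequently_le (hq0 α).frequently (isBoundedUnder_of_eventually_le (hq α hα))
  change _ ≤ ⨆ α ∈ Ioo a b, L α
  set M : ℝ := ⨆ α ∈ Ioo a b, L α
  have hM0 : 0 ≤ M := Real.iSup_nonneg fun α => Real.iSup_nonneg fun hα => hL0 α hα
  have hLM : ∀ α ∈ Ioo a b, L α ≤ M := by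
    intro α hα
    have hbdd : BddAbove (range fun α => ⨆ _ : α ∈ Ioo a b, L α) := by
      refine ⟨K, ?_⟩
      rintro _ ⟨β, rfl⟩
      exact Real.iSup_le (hLK β) K.2
    exact (ciSup_pos (f := fun _ => L α) hα).ge.trans (le_ciSup hbdd α)
  refine limsup_le_of_le (isBoundedUnder_of_eventually_ge (a := 0) ?_).isCoboundedUnder_le ?_
  · filter_upwards [self_mem_nhdsWithin] with s hs
    have hs : 0 < s := hs
    exact Real.iSup_nonneg fun α => Real.iSup_nonneg fun _ => by positivity
  filter_upwards [self_mem_nhdsWithin] with s hs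
  have hs : 0 < s := hs
  refine Real.iSup_le (fun α => Real.iSup_le (fun hα => ?_) hM0) hM0
  obtain ⟨hα, hαs⟩ := hα
  rw [div_le_iff₀ hs]
  have hmem : ∀ t ∈ Icc 0 s, α - t ∈ Ioo a b := fun t ht =>
    ⟨by linarith [ht.2, hαs.1], by linarith [ht.1, hα.2]⟩
  have key := norm_sub_le_of_frequently_right_quotient_lt (g := fun t => f (α - t)) (M := M) hs.le
    (hf.continuousOn.comp (by fun_prop) hmem) (fun t ht r hr => ?_)
  · simpa using key
  have ht' := hmem t (Ico_subset_Icc_self ht)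
  have hlt : limsup (fun u : ℝ => ‖f (α - t - u) - f (α - t)‖ / u) (𝓝[>] 0) < r := by
    rw [← hLeq _ ht']
    exact (hLM _ ht').trans_lt hr
  simpa only [sub_sub] using
    (eventually_lt_of_limsup_lt hlt (isBoundedUnder_of_eventually_le (hq _ ht'))).frequently
end

section
/- Let T > 0, K₀ > 0, ω ∈ ℝ and λ > 0 with λω < 1. Define the bounded linear operator S_λ on C([0,T],ℂ) by (S_λ g)(t) = (K₀/(1−λω)) ∫₀ᵗ exp(−ωs/(1−λω)) g(t−s) ds. Then the spectrum of the operator (λK₀/(1−λω))·I + S_λ on C([0,T],ℂ) is exactly the singleton { λK₀/(1−λω) }. -/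
/-- The convolution Volterra operator `(V g)(t) = ∫₀ᵗ k(s) g(t - s) ds` on `C([0,T],ℂ)`. -/
noncomputable def volterraConv {T : ℝ} (hT : 0 ≤ T) (k : C(ℝ, ℂ)) :
    C(Set.Icc (0:ℝ) T, ℂ) →L[ℂ] C(Set.Icc (0:ℝ) T, ℂ) :=
  have hint (g : C(Set.Icc (0:ℝ) T, ℂ)) (t : Set.Icc (0:ℝ) T) :
      IntervalIntegrable (fun s => k s * g (Set.projIcc 0 T hT ((t:ℝ) - s)))
        MeasureTheory.volume 0 t :=
    Continuous.intervalIntegrable (by fun_prop) _ _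
  have hbdd : ∃ M : ℝ, ∀ s ∈ Set.Icc 0 T, ‖k s‖ ≤ M :=
    isCompact_Icc.exists_bound_of_continuousOn k.continuous.continuousOn
  LinearMap.mkContinuousOfExistsBound
    { toFun := fun g =>
        ⟨fun t => ∫ s in (0:ℝ)..(t:ℝ), k s * g (Set.projIcc 0 T hT ((t:ℝ) - s)),
          intervalIntegral.continuous_parametric_intervalIntegral_of_continuous
            (by fun_prop) continuous_subtype_val⟩
      map_add' := fun f g => by
        ext t
        simpa [mul_add] using intervalIntegral.integral_add (hint f t) (hint g t)
      map_smul' := fun a g => by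
        ext t
        simp [mul_left_comm _ a] }
    (by
      obtain ⟨M, hM⟩ := hbdd
      have hM0 : 0 ≤ M := (norm_nonneg _).trans (hM 0 ⟨le_rfl, hT⟩)
      refine ⟨M * T, fun g => (ContinuousMap.norm_le _ (by positivity)).2 fun t => ?_⟩
      calc _ ≤ M * ‖g‖ * |(t:ℝ) - 0| :=
            intervalIntegral.norm_integral_le_of_norm_le_const fun s hs => by
              rw [Set.uIoc_of_le t.2.1] at hs
              rw [norm_mul]
              exact mul_le_mul (hM s ⟨hs.1.le, hs.2.trans t.2.2⟩) (g.norm_coe_le_norm _)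
                (norm_nonneg _) hM0
        _ ≤ M * ‖g‖ * T := by
              rw [sub_zero, abs_of_nonneg t.2.1]
              gcongr
              exact t.2.2
        _ = M * T * ‖g‖ := by ring)

theorem volterraConv_apply {T : ℝ} (hT : 0 ≤ T) (k : C(ℝ, ℂ)) (g : C(Set.Icc (0:ℝ) T, ℂ))
    (t : Set.Icc (0:ℝ) T) :
    volterraConv hT k g t =
      ∫ s in (0:ℝ)..(t:ℝ), k s * g (Set.projIcc 0 T hT ((t:ℝ) - s)) :=
  rfl

theorem norm_volterraConv_pow_apply_le {T M : ℝ} (hT : 0 ≤ T) (k : C(ℝ, ℂ))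
    (hM : ∀ s ∈ Set.Icc 0 T, ‖k s‖ ≤ M) (g : C(Set.Icc (0:ℝ) T, ℂ)) (n : ℕ)
    (t : Set.Icc (0:ℝ) T) :
    ‖(volterraConv hT k ^ n) g t‖ ≤ M ^ n * ((t:ℝ) ^ n / n.factorial) * ‖g‖ := by
  have hM0 : 0 ≤ M := (norm_nonneg _).trans (hM 0 ⟨le_rfl, hT⟩)
  induction n generalizing t with
  | zero => simpa using g.norm_coe_le_norm t
  | succ n ih =>
    rw [pow_succ', mul_apply_eq_comp, volterraConv_apply]
    calc _ ≤ ∫ s in (0:ℝ)..(t:ℝ), M ^ (n + 1) * ‖g‖ / n.factorial * ((t:ℝ) - s) ^ n := by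
          refine intervalIntegral.norm_integral_le_of_norm_le t.2.1 (MeasureTheory.ae_of_all _ fun s hs => ?_)
            (Continuous.intervalIntegrable (by fun_prop) _ _)
          have hs' : (t:ℝ) - s ∈ Set.Icc 0 T :=
            ⟨sub_nonneg.2 hs.2, by linarith [hs.1, t.2.2]⟩
          rw [norm_mul, Set.projIcc_of_mem hT hs']
          calc _ ≤ M * (M ^ n * (((t:ℝ) - s) ^ n / n.factorial) * ‖g‖) :=
                mul_le_mul (hM s ⟨hs.1.le, hs.2.trans t.2.2⟩) (ih _) (norm_nonneg _) hM0
            _ = _ := by ring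
      _ = _ := by
          rw [intervalIntegral.integral_const_mul,
            intervalIntegral.integral_comp_sub_left (fun x => x ^ n), integral_pow,
            Nat.factorial_succ]
          have := n.factorial_ne_zero
          push_cast
          field_simp
          simp

theorem norm_volterraConv_pow_le {T M : ℝ} (hT : 0 ≤ T) (k : C(ℝ, ℂ))
    (hM : ∀ s ∈ Set.Icc 0 T, ‖k s‖ ≤ M) (n : ℕ) :
    ‖volterraConv hT k ^ n‖ ≤ (M * T) ^ n / n.factorial := by
  have hM0 : 0 ≤ M := (norm_nonneg _).trans (hM 0 ⟨le_rfl, hT⟩)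
  refine ContinuousLinearMap.opNorm_le_bound _ (by positivity) fun g =>
    (ContinuousMap.norm_le _ (by positivity)).2 fun t => ?_
  refine (norm_volterraConv_pow_apply_le hT k hM g n t).trans ?_
  rw [mul_pow, mul_div_assoc]
  have := t.2.1
  gcongr
  exact t.2.2

/-- Convolution Volterra operators are quasinilpotent. -/
theorem spectrum_volterraConv {T : ℝ} (hT : 0 ≤ T) (k : C(ℝ, ℂ)) :
    spectrum ℂ (volterraConv hT k) = {0} := by
  have : Nonempty (Set.Icc (0:ℝ) T) := ⟨⟨0, le_rfl, hT⟩⟩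
  obtain ⟨M, hM⟩ : ∃ M : ℝ, ∀ s ∈ Set.Icc 0 T, ‖k s‖ ≤ M :=
    isCompact_Icc.exists_bound_of_continuousOn k.continuous.continuousOn
  refine (spectrum.nonempty (volterraConv hT k)).subset_singleton_iff.1 fun z hz => ?_
  by_contra hz0
  have hz' : 0 < ‖z‖ := norm_pos_iff.2 hz0
  have hlim := FloorSemiring.tendsto_pow_div_factorial_atTop (M * T / ‖z‖)
  obtain ⟨n, hn⟩ := (hlim.eventually (gt_mem_nhds one_pos)).exists
  have hle : ‖z‖ ^ n ≤ (M * T) ^ n / n.factorial := by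
    rw [← norm_pow]
    exact (spectrum.norm_le_norm_of_mem (spectrum.pow_mem_pow _ n hz)).trans
      (norm_volterraConv_pow_le hT k hM n)
  rw [div_pow, div_right_comm, div_lt_one (by positivity)] at hn
  exact hn.not_ge hle


/-- For the Volterra operator
`(S_λ g)(t) = (K₀/(1−λω)) ∫₀ᵗ exp(−ωs/(1−λω)) g(t−s) ds` on `C([0,T],ℂ)`, the spectrum
of `(λK₀/(1−λω))·I + S_λ` is exactly `{λK₀/(1−λω)}`. -/
theorem spectrum_smul_id_add_volterra (T : ℝ) (hT : 0 < T) (K₀ ω lam : ℝ)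
    (hK : 0 < K₀) (hlam : 0 < lam) (hlo : lam * ω < 1) :
    ∃ S : C(Set.Icc (0:ℝ) T, ℂ) →L[ℂ] C(Set.Icc (0:ℝ) T, ℂ),
      (∀ g : C(Set.Icc (0:ℝ) T, ℂ), ∀ t : Set.Icc (0:ℝ) T,
        S g t = ((K₀ / (1 - lam * ω) : ℝ) : ℂ) * ∫ s in (0:ℝ)..(t:ℝ),
          (Real.exp (-ω * s / (1 - lam * ω)) : ℂ) *
            g (Set.projIcc 0 T hT.le ((t:ℝ) - s))) ∧
      spectrum ℂ
          (((lam * K₀ / (1 - lam * ω) : ℝ) : ℂ) •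
              (1 : C(Set.Icc (0:ℝ) T, ℂ) →L[ℂ] C(Set.Icc (0:ℝ) T, ℂ)) + S)
        = {((lam * K₀ / (1 - lam * ω) : ℝ) : ℂ)} := by
  let k : C(ℝ, ℂ) := ⟨fun s => ((K₀ / (1 - lam * ω) : ℝ) : ℂ) *
    (Real.exp (-ω * s / (1 - lam * ω)) : ℂ), by fun_prop⟩
  refine ⟨volterraConv hT.le k, fun g t => ?_, ?_⟩
  · simp only [volterraConv_apply, k, ContinuousMap.coe_mk, mul_assoc,
      intervalIntegral.integral_const_mul]
  · refine (spectrum.singleton_add_eq (volterraConv hT.le k) _).symm.trans ?_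
    rw [spectrum_volterraConv, Set.singleton_add_singleton, add_zero]
end

section
/- Let X be a real Banach space, T > 0, λ > 0, c ≥ 0, x₀ ∈ X, and let J : [0,T] × X → X be continuous with ‖J(t,x) − J(t,y)‖ ≤ c‖x − y‖ for all t ∈ [0,T] and x, y ∈ X. Then the map F on C([0,T],X) defined by F(u)(t) = J(t, exp(−t/λ) x₀ + (1/λ) ∫₀ᵗ exp(−τ/λ) u(t−τ) dτ) maps C([0,T],X) into itself and has a unique fixed point u ∈ C([0,T],X), i.e., there is exactly one continuous u : [0,T] → X with u(t) = J(t, exp(−t/λ) x₀ + (1/λ) ∫₀ᵗ exp(−τ/λ) u(t−τ) dτ) for all t ∈ [0,T]. -/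
/-- The Yosida-type regularization of `u` with parameter `lam` and initial value `x₀`. -/
noncomputable def yosidaRegularization {X : Type*} [NormedAddCommGroup X] [NormedSpace ℝ X]
    {T : ℝ} (hT : 0 ≤ T) (lam : ℝ) (x₀ : X) (u : C(Set.Icc (0:ℝ) T, X)) (t : ℝ) : X :=
  Real.exp (-t / lam) • x₀ +
    (1 / lam) • ∫ τ in (0:ℝ)..t,
      Real.exp (-τ / lam) • u (Set.projIcc 0 T hT (t - τ))

section

variable {X : Type*} [NormedAddCommGroup X] [NormedSpace ℝ X]
  {T : ℝ} (hT : 0 ≤ T) (lam : ℝ) (x₀ : X)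

theorem continuous_yosidaRegularization (u : C(Set.Icc (0:ℝ) T, X)) :
    Continuous (yosidaRegularization hT lam x₀ u) := by
  unfold yosidaRegularization
  have h : Continuous fun t : ℝ => ∫ τ in (0:ℝ)..t,
      Real.exp (-τ / lam) • u (Set.projIcc 0 T hT (t - τ)) := by
    apply intervalIntegral.continuous_parametric_intervalIntegral_of_continuous _ continuous_id
    have := continuous_projIcc (h := hT)
    fun_prop
  fun_prop

theorem norm_yosidaRegularization_sub_le (hlam : 0 < lam) (u v : C(Set.Icc (0:ℝ) T, X))
    (M : ℝ) (n : ℕ)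
    (huv : ∀ s : Set.Icc (0:ℝ) T, ‖u s - v s‖ ≤ M * (s:ℝ) ^ n) {t : ℝ}
    (ht : t ∈ Set.Icc 0 T) :
    ‖yosidaRegularization hT lam x₀ u t - yosidaRegularization hT lam x₀ v t‖ ≤
      (1 / lam) * (M * (t ^ (n + 1) / (n + 1))) := by
  have hp := continuous_projIcc (h := hT)
  have hi (w : C(Set.Icc (0:ℝ) T, X)) : IntervalIntegrable
      (fun τ => Real.exp (-τ / lam) • w (Set.projIcc 0 T hT (t - τ)))
      MeasureTheory.volume 0 t :=
    Continuous.intervalIntegrable (by fun_prop) _ _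
  unfold yosidaRegularization
  rw [add_sub_add_left_eq_sub, ← smul_sub, ← intervalIntegral.integral_sub (hi u) (hi v),
    norm_smul, Real.norm_of_nonneg (by positivity)]
  gcongr
  have hb : ∫ τ in (0:ℝ)..t, M * (t - τ) ^ n = M * (t ^ (n + 1) / (n + 1)) := by
    rw [intervalIntegral.integral_const_mul,
      intervalIntegral.integral_comp_sub_left (fun s => s ^ n) t, integral_pow]
    simp
  rw [← hb]
  refine intervalIntegral.norm_integral_le_of_norm_le ht.1 (Filter.Eventually.of_forall ?_)
    (Continuous.intervalIntegrable (by fun_prop) _ _)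
  intro τ hτ
  have hmem : t - τ ∈ Set.Icc 0 T := ⟨by linarith [hτ.2], by linarith [hτ.1, ht.2]⟩
  have hexp : Real.exp (-τ / lam) ≤ 1 :=
    Real.exp_le_one_iff.2 (div_nonpos_of_nonpos_of_nonneg (by linarith [hτ.1]) hlam.le)
  rw [← smul_sub, norm_smul, Real.norm_of_nonneg (Real.exp_pos _).le,
    Set.projIcc_of_mem hT hmem]
  exact (mul_le_of_le_one_left (norm_nonneg _) hexp).trans (huv ⟨t - τ, hmem⟩)

/-- The map `u ↦ J(·, u_lam)` on `C([0,T],X)`, where `u_lam` is the Yosida-type regularization. -/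
noncomputable def yosidaMap (J : ℝ → X → X)
    (hJ : ContinuousOn (fun p : ℝ × X => J p.1 p.2) (Set.Icc 0 T ×ˢ Set.univ))
    (u : C(Set.Icc (0:ℝ) T, X)) : C(Set.Icc (0:ℝ) T, X) where
  toFun t := J t (yosidaRegularization hT lam x₀ u t)
  continuous_toFun := by
    have h := continuous_yosidaRegularization hT lam x₀ u
    exact hJ.comp_continuous (f := fun t : Set.Icc (0:ℝ) T =>
      ((t:ℝ), yosidaRegularization hT lam x₀ u t)) (by fun_prop) fun t => ⟨t.2, Set.mem_univ _⟩

theorem norm_iterate_yosidaMap_sub_le (hlam : 0 < lam) {c : ℝ} (hc : 0 ≤ c) (J : ℝ → X → X)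
    (hJ : ContinuousOn (fun p : ℝ × X => J p.1 p.2) (Set.Icc 0 T ×ˢ Set.univ))
    (hJlip : ∀ t ∈ Set.Icc (0:ℝ) T, ∀ x y : X, ‖J t x - J t y‖ ≤ c * ‖x - y‖)
    (u v : C(Set.Icc (0:ℝ) T, X)) (n : ℕ) (t : Set.Icc (0:ℝ) T) :
    ‖(yosidaMap hT lam x₀ J hJ)^[n] u t - (yosidaMap hT lam x₀ J hJ)^[n] v t‖ ≤
      (dist u v * (c / lam) ^ n / n.factorial) * (t:ℝ) ^ n := by
  induction n generalizing t with
  | zero =>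
    simpa [dist_eq_norm] using ContinuousMap.dist_apply_le_dist (f := u) (g := v) t
  | succ n ih =>
    rw [Function.iterate_succ_apply', Function.iterate_succ_apply']
    refine (hJlip t t.2 _ _).trans ((mul_le_mul_of_nonneg_left
      (norm_yosidaRegularization_sub_le hT lam x₀ hlam _ _ _ n ih t.2) hc).trans_eq ?_)
    rw [Nat.factorial_succ, pow_succ (c / lam)]
    push_cast
    field_simp

theorem exists_contractingWith_iterate_yosidaMap (hlam : 0 < lam) {c : ℝ} (hc : 0 ≤ c)
    (J : ℝ → X → X)
    (hJ : ContinuousOn (fun p : ℝ × X => J p.1 p.2) (Set.Icc 0 T ×ˢ Set.univ))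
    (hJlip : ∀ t ∈ Set.Icc (0:ℝ) T, ∀ x y : X, ‖J t x - J t y‖ ≤ c * ‖x - y‖) :
    ∃ (n : ℕ) (K : NNReal), ContractingWith K (yosidaMap hT lam x₀ J hJ)^[n] := by
  obtain ⟨n, hn⟩ := ((FloorSemiring.tendsto_pow_div_factorial_atTop (c / lam * T)).eventually
    (gt_mem_nhds zero_lt_one)).exists
  have h0 : 0 ≤ (c / lam * T) ^ n / n.factorial := by positivity
  refine ⟨n, NNReal.mk _ h0, hn, LipschitzWith.of_dist_le_mul fun u v => ?_⟩
  rw [NNReal.coe_mk, ContinuousMap.dist_le (by positivity)]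
  intro t
  rw [dist_eq_norm]
  have ht0 := t.2.1
  calc _ ≤ (dist u v * (c / lam) ^ n / n.factorial) * (t:ℝ) ^ n :=
        norm_iterate_yosidaMap_sub_le hT lam x₀ hlam hc J hJ hJlip u v n t
    _ ≤ (dist u v * (c / lam) ^ n / n.factorial) * T ^ n := by
        gcongr
        exact t.2.2
    _ = _ := by rw [mul_pow]; ring

end

/-- For `J : [0,T] × X → X` continuous and Lipschitz in the second
variable, the Yosida-type fixed point map
`F(u)(t) = J(t, exp(−t/λ)x₀ + (1/λ)∫₀ᵗ exp(−τ/λ) u(t−τ) dτ)` has a unique fixed point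
in `C([0,T],X)`. -/
theorem yosida_fixed_point {X : Type*} [NormedAddCommGroup X] [NormedSpace ℝ X]
    [CompleteSpace X] (T lam c : ℝ) (hT : 0 < T) (hlam : 0 < lam) (hc : 0 ≤ c)
    (x₀ : X) (J : ℝ → X → X)
    (hJcont : ContinuousOn (fun p : ℝ × X => J p.1 p.2) (Set.Icc 0 T ×ˢ Set.univ))
    (hJlip : ∀ t ∈ Set.Icc (0:ℝ) T, ∀ x y : X, ‖J t x - J t y‖ ≤ c * ‖x - y‖) :
    ∃! u : C(Set.Icc (0:ℝ) T, X),
      ∀ t : Set.Icc (0:ℝ) T,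
        u t = J t (Real.exp (-(t:ℝ) / lam) • x₀ +
          (1 / lam) • ∫ τ in (0:ℝ)..(t:ℝ),
            Real.exp (-τ / lam) • u (Set.projIcc 0 T hT.le ((t:ℝ) - τ))) := by
  obtain ⟨n, K, hK⟩ :=
    exists_contractingWith_iterate_yosidaMap hT.le lam x₀ hlam hc J hJcont hJlip
  have hiff (u : C(Set.Icc (0:ℝ) T, X)) :
      (∀ t : Set.Icc (0:ℝ) T, u t = J t (yosidaRegularization hT.le lam x₀ u t)) ↔
        Function.IsFixedPt (yosidaMap hT.le lam x₀ J hJcont) u :=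
    ⟨fun h => ContinuousMap.ext fun t => (h t).symm, fun h t => (DFunLike.congr_fun h t).symm⟩
  refine ⟨hK.fixedPoint, (hiff _).2 hK.isFixedPt_fixedPoint_iterate, fun u hu => ?_⟩
  exact hK.fixedPoint_unique (((hiff u).1 hu).iterate n)
end

section
/- Let X be a real Banach space. Call a bounded uniformly continuous function f : [0,∞) → X asymptotically almost periodic (AAP) if the set of its translates { s ↦ f(s+h) : h ≥ 0 } is relatively compact in the space of bounded continuous X-valued functions on [0,∞) with the sup norm. Let κ ≥ 0 and let J : [0,∞) × X → X satisfy: (i) ‖J(t,x) − J(t,y)‖ ≤ κ ‖x − y‖ for all t ≥ 0 and x, y ∈ X; (ii) for every x ∈ X the function t ↦ J(t,x) is bounded, uniformly continuous and AAP. Then for every AAP function f : [0,∞) → X, the function t ↦ J(t, f(t)) is AAP. -/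
/-- The translation map `s ↦ s + h` on `[0,∞)` for `h ≥ 0`, as a continuous map. -/
noncomputable def shiftIci (h : ℝ) (hh : 0 ≤ h) :
    C(Set.Ici (0:ℝ), Set.Ici (0:ℝ)) :=
  ⟨fun s => ⟨(s : ℝ) + h, Set.mem_Ici.mpr (add_nonneg s.2 hh)⟩,
    (continuous_subtype_val.add continuous_const).subtype_mk _⟩

/-- A bounded continuous function `f : [0,∞) → X` is asymptotically almost periodic if
the set of its forward translates `{s ↦ f(s+h) : h ≥ 0}` is relatively compact in
`BC([0,∞), X)` with the sup norm. -/
def IsAAP {X : Type*} [NormedAddCommGroup X]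
    (f : BoundedContinuousFunction (Set.Ici (0:ℝ)) X) : Prop :=
  IsCompact (closure
    {g : BoundedContinuousFunction (Set.Ici (0:ℝ)) X |
      ∃ h : ℝ, ∃ hh : 0 ≤ h, g = f.compContinuous (shiftIci h hh)})

section Superposition

open Filter

theorem totallyBounded_range_iff_ultrafilter {ι α : Type*} [UniformSpace α] {F : ι → α} :
    TotallyBounded (Set.range F) ↔ ∀ U : Ultrafilter ι, Cauchy (map F (U : Filter ι)) := by
  rw [totallyBounded_iff_ultrafilter]
  refine ⟨fun h U => h (U.map F) ?_, fun h V hV => ?_⟩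
  · rw [Ultrafilter.coe_map, le_principal_iff]
    exact range_mem_map
  · have hne : (comap F (V : Filter α)).NeBot :=
      V.neBot.comap_of_range_mem (le_principal_iff.mp hV)
    have hle : ((Ultrafilter.of (comap F (V : Filter α))).map F : Filter α) ≤ V :=
      map_le_iff_le_comap.mpr (Ultrafilter.of_le _)
    rw [← Ultrafilter.coe_le_coe.mp hle]
    exact h _

theorem totallyBounded_range_iff_eventually_dist {ι α : Type*} [PseudoMetricSpace α] {F : ι → α} :
    TotallyBounded (Set.range F) ↔ ∀ U : Ultrafilter ι, ∀ ε > 0,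
      ∀ᶠ p in (U : Filter ι) ×ˢ (U : Filter ι), dist (F p.1) (F p.2) < ε := by
  rw [totallyBounded_range_iff_ultrafilter]
  refine forall_congr' fun U => ?_
  rw [cauchy_map_iff, Metric.uniformity_basis_dist.tendsto_right_iff]
  exact and_iff_right U.neBot

section AAP

variable {X : Type*} [NormedAddCommGroup X]

/-- The forward translate `s ↦ f (s + h)`. -/
noncomputable def translateIci (f : BoundedContinuousFunction (Set.Ici (0:ℝ)) X)
    (h : Set.Ici (0:ℝ)) : BoundedContinuousFunction (Set.Ici (0:ℝ)) X :=
  f.compContinuous (shiftIci h h.2)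

theorem translateIci_apply (f : BoundedContinuousFunction (Set.Ici (0:ℝ)) X)
    (h s : Set.Ici (0:ℝ)) : translateIci f h s = f (shiftIci h h.2 s) := rfl

theorem isAAP_iff_totallyBounded [CompleteSpace X]
    {f : BoundedContinuousFunction (Set.Ici (0:ℝ)) X} :
    IsAAP f ↔ TotallyBounded (Set.range (translateIci f)) := by
  have hset : {g : BoundedContinuousFunction (Set.Ici (0:ℝ)) X |
      ∃ h : ℝ, ∃ hh : 0 ≤ h, g = f.compContinuous (shiftIci h hh)} =
        Set.range (translateIci f) := by
    ext g
    exact ⟨fun ⟨h, hh, hg⟩ => ⟨⟨h, hh⟩, hg.symm⟩, fun ⟨h, hg⟩ => ⟨h, h.2, hg.symm⟩⟩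
  rw [IsAAP, hset]
  exact ⟨fun h => h.totallyBounded.subset subset_closure,
    fun h => h.closure.isCompact_of_isClosed isClosed_closure⟩

theorem IsAAP.totallyBounded_range [CompleteSpace X]
    {f : BoundedContinuousFunction (Set.Ici (0:ℝ)) X} (hf : IsAAP f) :
    TotallyBounded (Set.range f) := by
  have h0 : (0 : ℝ) ∈ Set.Ici (0:ℝ) := Set.self_mem_Ici
  refine ((isAAP_iff_totallyBounded.mp hf).image
    (BoundedContinuousFunction.lipschitz_eval_const
      (⟨0, h0⟩ : Set.Ici (0:ℝ))).uniformContinuous).subset ?_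
  rintro _ ⟨t, rfl⟩
  refine ⟨_, ⟨t, rfl⟩, ?_⟩
  change f (shiftIci t t.2 ⟨0, h0⟩) = f t
  congr 1
  exact Subtype.ext (zero_add _)

/-- A superposition of a uniformly Lipschitz family of asymptotically almost periodic functions
with an asymptotically almost periodic function is asymptotically almost periodic. -/
theorem IsAAP.superposition [CompleteSpace X] {κ : ℝ} (hκ : 0 ≤ κ)
    {j : X → BoundedContinuousFunction (Set.Ici (0:ℝ)) X}
    (hlip : ∀ t x y, dist (j x t) (j y t) ≤ κ * dist x y) (hj : ∀ x, IsAAP (j x))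
    {f g : BoundedContinuousFunction (Set.Ici (0:ℝ)) X} (hf : IsAAP f)
    (hg : ∀ t, g t = j (f t) t) : IsAAP g := by
  rw [isAAP_iff_totallyBounded, totallyBounded_range_iff_eventually_dist]
  intro U ε hε
  set δ := ε / (3 * κ + 2) with hδ
  have hδ0 : 0 < δ := by positivity
  have hδε : (3 * κ + 1) * δ < ε := by
    have : (3 * κ + 2) * δ = ε := by rw [hδ]; field_simp
    linarith
  obtain ⟨N, hN, hcov⟩ := Metric.totallyBounded_iff.mp hf.totallyBounded_range δ hδ0
  have hUf := totallyBounded_range_iff_eventually_dist.mp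
    (isAAP_iff_totallyBounded.mp hf) U δ hδ0
  have hUj := (eventually_all_finite hN).mpr fun x _ =>
    totallyBounded_range_iff_eventually_dist.mp (isAAP_iff_totallyBounded.mp (hj x)) U δ hδ0
  filter_upwards [hUf, hUj] with p hpf hpj
  refine lt_of_le_of_lt ((BoundedContinuousFunction.dist_le (by positivity)).mpr fun s => ?_) hδε
  have hfs := (BoundedContinuousFunction.dist_coe_le_dist s).trans hpf.le
  simp only [translateIci_apply] at hfs ⊢
  set a := shiftIci p.1 p.1.2 s
  set b := shiftIci p.2 p.2.2 s
  obtain ⟨x, hxN, hx⟩ := Set.mem_iUnion₂.mp (hcov ⟨b, rfl⟩)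
  have hx' : dist (f b) x ≤ δ := (Metric.mem_ball.mp hx).le
  have hjs : dist (j x a) (j x b) ≤ δ :=
    (BoundedContinuousFunction.dist_coe_le_dist s).trans (hpj x hxN).le
  rw [hg, hg]
  calc dist (j (f a) a) (j (f b) b)
      ≤ dist (j (f a) a) (j (f b) a) + dist (j (f b) a) (j x a)
          + dist (j x a) (j x b) + dist (j x b) (j (f b) b) :=
        (dist_triangle _ (j x b) _).trans
          (add_le_add_left (dist_triangle4 _ _ _ _) _)
    _ ≤ κ * δ + κ * δ + δ + κ * δ := by
        gcongr
        · exact (hlip _ _ _).trans (by gcongr)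
        · exact (hlip _ _ _).trans (by gcongr)
        · exact (hlip _ _ _).trans (by rw [dist_comm]; gcongr)
    _ = (3 * κ + 1) * δ := by ring

end AAP

end Superposition

/-- If `J(t,·)` is uniformly `κ`-Lipschitz and `t ↦ J(t,x)` is bounded,
uniformly continuous and asymptotically almost periodic for every `x`, then `t ↦ J(t,f(t))`
is asymptotically almost periodic for every bounded uniformly continuous AAP `f`. -/
theorem aap_superposition {X : Type*} [NormedAddCommGroup X] [NormedSpace ℝ X]
    [CompleteSpace X] (κ : ℝ) (hκ : 0 ≤ κ) (J : ℝ → X → X)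
    (hlip : ∀ t ≥ (0:ℝ), ∀ x y : X, ‖J t x - J t y‖ ≤ κ * ‖x - y‖)
    (haap : ∀ x : X, ∃ j : BoundedContinuousFunction (Set.Ici (0:ℝ)) X,
      (∀ t : Set.Ici (0:ℝ), j t = J t x) ∧ UniformContinuous ⇑j ∧ IsAAP j) :
    ∀ f : BoundedContinuousFunction (Set.Ici (0:ℝ)) X,
      UniformContinuous ⇑f → IsAAP f →
      ∃ g : BoundedContinuousFunction (Set.Ici (0:ℝ)) X,
        (∀ t : Set.Ici (0:ℝ), g t = J t (f t)) ∧ IsAAP g := by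
  intro f _ hf
  choose j hjJ _ hj using haap
  have hl : ∀ t x y, dist (j x t) (j y t) ≤ κ * dist x y := fun t x y => by
    rw [hjJ, hjJ, dist_eq_norm, dist_eq_norm]
    exact hlip t t.2 x y
  have hcont : Continuous fun q : X × Set.Ici (0:ℝ) => j q.1 q.2 :=
    continuous_prod_of_continuous_lipschitzWith _ ⟨κ, hκ⟩ (fun x => (j x).continuous)
      fun t => LipschitzWith.of_dist_le_mul (hl t)
  let g : BoundedContinuousFunction (Set.Ici (0:ℝ)) X :=
    BoundedContinuousFunction.ofNormedAddCommGroup (fun t => j (f t) t)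
      (hcont.comp (f.continuous.prodMk continuous_id)) (κ * ‖f‖ + ‖j 0‖) fun t => by
        have h := hl t (f t) 0
        rw [dist_eq_norm, dist_zero_right] at h
        calc ‖j (f t) t‖ ≤ ‖j (f t) t - j 0 t‖ + ‖j 0 t‖ := norm_le_norm_sub_add _ _
          _ ≤ κ * ‖f t‖ + ‖j 0 t‖ := by gcongr
          _ ≤ κ * ‖f‖ + ‖j 0‖ := by
            gcongr
            · exact f.norm_coe_le_norm t
            · exact (j 0).norm_coe_le_norm t
  exact ⟨g, fun t => hjJ (f t) t, hf.superposition hκ hl hj fun _ => rfl⟩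
end
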